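/- arXiv:2203.00958 — 2 statements merged into one kernel-verified Lean document; each statement's English description precedes it below -/
import Mathlib

section
/- Let F be a finite field with q elements, r ∈ (0,1) and δ ∈ (0, 1−1/q). For each integer n with ⌊rn⌋ ≥ 1 let k = ⌊rn⌋ and, for M ∈ F^{k×n}, let C_M = {bM : b ∈ F^k} ≤ F^n. Let Q_n = |{M ∈ F^{k×n} : rank M = k and every nonzero codeword of C_M has Hamming weight > δn}| / |{M ∈ F^{k×n} : rank M = k}|. Then lim_{n→∞} Q_n = 1 if r < g_q(δ), and lim_{n→∞} Q_n = 0 if r > g_q(δ). -/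
/-- The `q`-entropy function `h_q(δ)`. -/
noncomputable def qEntropy (q : ℕ) (δ : ℝ) : ℝ :=
  δ * Real.logb q ((q : ℝ) - 1) - δ * Real.logb q δ - (1 - δ) * Real.logb q (1 - δ)

/-- The asymptotic Gilbert–Varshamov bound `g_q(δ) = 1 - h_q(δ)`. -/
noncomputable def gvBound (q : ℕ) (δ : ℝ) : ℝ := 1 - qEntropy q δ

/-- The conditional probability, for a uniformly random `k × n` matrix `M` over `F`
with `k = ⌊rn⌋`, that every nonzero codeword of the row-span `C_M = {bM}` has
Hamming weight `> δn`, given that `M` has full rank `k`. -/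
noncomputable def Qlin (F : Type) [Field F] [Fintype F] [DecidableEq F]
    (r δ : ℝ) (n : ℕ) : ℝ :=
  ({M : Matrix (Fin ⌊r * (n : ℝ)⌋₊) (Fin n) F |
      M.rank = ⌊r * (n : ℝ)⌋₊ ∧
      ∀ b : Fin ⌊r * (n : ℝ)⌋₊ → F, Matrix.vecMul b M ≠ 0 →
        δ * n < (hammingNorm (Matrix.vecMul b M) : ℝ)}.ncard : ℝ) /
    ({M : Matrix (Fin ⌊r * (n : ℝ)⌋₊) (Fin n) F | M.rank = ⌊r * (n : ℝ)⌋₊}.ncard : ℝ)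

section RandomFamily

variable {F V : Type*} [Field F] [AddCommGroup V] [Module F V]

theorem LinearIndependent.exists_linearEquiv_comp_eq [FiniteDimensional F V] {m : ℕ}
    {w w' : Fin m → V} (hw : LinearIndependent F w) (hw' : LinearIndependent F w') :
    ∃ e : V ≃ₗ[F] V, ∀ i, e (w i) = w' i := by
  have : FiniteDimensional F (Submodule.span F (Set.range w)) :=
    FiniteDimensional.span_of_finite F (Set.finite_range _)
  obtain ⟨g, hg⟩ := Submodule.exists_linearEquiv_restrict_eq
    (hw.linearCombinationEquiv.symm ≪≫ₗ hw'.linearCombinationEquiv)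
  refine ⟨g, fun i => ?_⟩
  have h1 : ((hw.linearCombinationEquiv (Finsupp.single i 1) : _) : V) = w i := by simp
  rw [← h1, ← hg]
  simp

open Classical in
/-- The linearly independent families of `k` vectors. -/
noncomputable def linIndepFamilies (F V : Type*) [Field F] [AddCommGroup V] [Module F V]
    [Fintype V] (k : ℕ) : Finset (Fin k → V) :=
  Finset.univ.filter fun M => LinearIndependent F M

theorem mem_linIndepFamilies [Fintype V] {k : ℕ} {M : Fin k → V} :
    M ∈ linIndepFamilies F V k ↔ LinearIndependent F M := by
  simp [linIndepFamilies]

open Classical in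
theorem card_linIndepFamilies [Fintype F] [Fintype V] {k : ℕ}
    (hk : k ≤ Module.finrank F V) :
    (linIndepFamilies F V k).card =
      ∏ i : Fin k, (Fintype.card F ^ Module.finrank F V - Fintype.card F ^ (i : ℕ)) := by
  rw [← card_linearIndependent hk, linIndepFamilies, Nat.card_eq_fintype_card,
    Fintype.card_subtype]

open Classical in
theorem card_linIndepFamilies_fiber_eq [Fintype V] {k m : ℕ} (b : Fin m → Fin k → F)
    {w w' : Fin m → V} (hw : LinearIndependent F w) (hw' : LinearIndependent F w') :
    ((linIndepFamilies F V k).filter fun M =>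
        (fun i => Fintype.linearCombination F M (b i)) = w).card =
      ((linIndepFamilies F V k).filter fun M =>
        (fun i => Fintype.linearCombination F M (b i)) = w').card := by
  obtain ⟨e, he⟩ := hw.exists_linearEquiv_comp_eq hw'
  have key : ∀ (g : V ≃ₗ[F] V) (M : Fin k → V) (c : Fin k → F),
      Fintype.linearCombination F (g ∘ M) c = g (Fintype.linearCombination F M c) := by
    intro g M c
    simp [Fintype.linearCombination_apply, map_sum]
  refine Finset.card_bij' (fun M _ => e ∘ M) (fun M _ => e.symm ∘ M) ?_ ?_ ?_ ?_
  · intro M hM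
    simp only [Finset.mem_filter, mem_linIndepFamilies, key] at hM ⊢
    refine ⟨hM.1.map' e.toLinearMap e.ker, ?_⟩
    funext i
    rw [congrFun hM.2 i, he]
  · intro M hM
    simp only [Finset.mem_filter, mem_linIndepFamilies, key] at hM ⊢
    refine ⟨hM.1.map' e.symm.toLinearMap e.symm.ker, ?_⟩
    funext i
    rw [congrFun hM.2 i, ← he, e.symm_apply_apply]
  · intro M _
    funext i
    simp
  · intro M _
    funext i
    simp

open Classical in
/-- The image of a linearly independent tuple of coefficient vectors under a uniformly random
linearly independent family is uniformly distributed over linearly independent tuples. -/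
theorem card_linIndepFamilies_filter_mul [Fintype V] {k m : ℕ} {b : Fin m → Fin k → F}
    (hb : LinearIndependent F b) (B : Finset V) :
    ((linIndepFamilies F V k).filter fun M =>
        ∀ i, Fintype.linearCombination F M (b i) ∈ B).card * (linIndepFamilies F V m).card =
      (linIndepFamilies F V k).card *
        ((linIndepFamilies F V m).filter fun w => ∀ i, w i ∈ B).card := by
  set S := linIndepFamilies F V k
  set T := linIndepFamilies F V m
  have hmap : ∀ M ∈ S, (fun i => Fintype.linearCombination F M (b i)) ∈ T := by
    intro M hM
    rw [mem_linIndepFamilies] at hM ⊢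
    refine hb.map' (Fintype.linearCombination F M) ?_
    rw [LinearMap.ker_eq_bot]
    exact LinearIndependent.fintypeLinearCombination_injective hM
  have h1 : ∀ w ∈ T, S.card = T.card *
      (S.filter fun M => (fun i => Fintype.linearCombination F M (b i)) = w).card := by
    intro w hw
    rw [Finset.card_eq_sum_card_fiberwise hmap, ← smul_eq_mul, ← Finset.sum_const]
    refine Finset.sum_congr rfl fun w' hw' => ?_
    exact card_linIndepFamilies_fiber_eq b (mem_linIndepFamilies.mp hw') (mem_linIndepFamilies.mp hw)
  have h2 : (S.filter fun M => ∀ i, Fintype.linearCombination F M (b i) ∈ B).card =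
      ∑ w ∈ T.filter (fun w => ∀ i, w i ∈ B),
        (S.filter fun M => (fun i => Fintype.linearCombination F M (b i)) = w).card := by
    rw [Finset.card_eq_sum_card_fiberwise (t := T.filter (fun w => ∀ i, w i ∈ B))
      (f := fun M i => Fintype.linearCombination F M (b i))]
    · refine Finset.sum_congr rfl fun w hw => ?_
      congr 1
      ext M
      simp only [Finset.mem_filter] at hw ⊢
      constructor
      · rintro ⟨⟨h, _⟩, h'⟩
        exact ⟨h, h'⟩
      · rintro ⟨h, rfl⟩
        exact ⟨⟨h, hw.2⟩, rfl⟩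
    · intro M hM
      simp only [Finset.coe_filter, Set.mem_ofPred_eq] at hM ⊢
      exact ⟨hmap M hM.1, hM.2⟩
  rw [h2, Finset.sum_mul, mul_comm S.card, ← smul_eq_mul, ← Finset.sum_const]
  refine Finset.sum_congr rfl fun w hw => ?_
  rw [h1 w (Finset.mem_filter.mp hw).1, mul_comm]

theorem card_linIndepFamilies_one [Fintype F] [Fintype V] (hV : 1 ≤ Module.finrank F V) :
    (linIndepFamilies F V 1).card = Fintype.card F ^ Module.finrank F V - 1 := by
  rw [card_linIndepFamilies hV]
  simp

theorem card_linIndepFamilies_two [Fintype F] [Fintype V] (hV : 2 ≤ Module.finrank F V) :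
    (linIndepFamilies F V 2).card = (Fintype.card F ^ Module.finrank F V - 1) *
      (Fintype.card F ^ Module.finrank F V - Fintype.card F) := by
  rw [card_linIndepFamilies hV]
  simp [Fin.prod_univ_two]

open Classical in
theorem card_filter_linearCombination_mem [Fintype F] [Fintype V] (hV : 1 ≤ Module.finrank F V)
    {k : ℕ} {b : Fin k → F} (hb : b ≠ 0) {B : Finset V} (hB : 0 ∉ B) :
    (((linIndepFamilies F V k).filter fun M => Fintype.linearCombination F M b ∈ B).card : ℝ) *
        ((Fintype.card F : ℝ) ^ Module.finrank F V - 1) =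
      (linIndepFamilies F V k).card * B.card := by
  have h := card_linIndepFamilies_filter_mul (V := V) (b := fun _ : Fin 1 => b)
    (by rw [linearIndependent_unique_iff]; exact hb) B
  rw [card_linIndepFamilies_one hV] at h
  have h2 : ((linIndepFamilies F V 1).filter fun w => ∀ i, w i ∈ B).card = B.card := by
    refine Finset.card_bij' (fun w _ => w 0) (fun v _ => fun _ => v) ?_ ?_ ?_ ?_
    · intro w hw
      exact (Finset.mem_filter.mp hw).2 0
    · intro v hv
      rw [Finset.mem_filter, mem_linIndepFamilies, linearIndependent_unique_iff]
      exact ⟨fun h => hB (h ▸ hv), fun _ => hv⟩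
    · intro w _
      funext i
      rw [Subsingleton.elim i 0]
    · intro v _
      rfl
  rw [h2] at h
  simp only [forall_const] at h
  rw [← Nat.cast_mul, ← h]
  push_cast [Nat.cast_sub (Nat.one_le_pow _ _ (Fintype.card_pos (α := F)))]
  rfl

open Classical in
theorem card_filter_linearCombination_mem_pair_le [Fintype F] [Fintype V]
    (hV : 2 ≤ Module.finrank F V) {k : ℕ} {b b' : Fin k → F}
    (hb : LinearIndependent F ![b, b']) (B : Finset V) :
    (((linIndepFamilies F V k).filter fun M => Fintype.linearCombination F M b ∈ B ∧
        Fintype.linearCombination F M b' ∈ B).card : ℝ) *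
        (((Fintype.card F : ℝ) ^ Module.finrank F V - 1) *
          ((Fintype.card F : ℝ) ^ Module.finrank F V - Fintype.card F)) ≤
      (linIndepFamilies F V k).card * (B.card : ℝ) ^ 2 := by
  have h := card_linIndepFamilies_filter_mul (V := V) hb B
  rw [card_linIndepFamilies_two hV] at h
  have h2 : ((linIndepFamilies F V 2).filter fun w => ∀ i, w i ∈ B).card ≤ B.card ^ 2 := by
    rw [sq, ← Finset.card_product]
    refine Finset.card_le_card_of_injOn (fun w => (w 0, w 1)) ?_ ?_
    · intro w hw
      have := (Finset.mem_filter.mp hw).2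
      exact Finset.mem_product.mpr ⟨this 0, this 1⟩
    · intro w _ w' _ hww
      simp only [Prod.mk.injEq] at hww
      funext i
      fin_cases i
      · exact hww.1
      · exact hww.2
  simp only [Fin.forall_fin_two, Matrix.cons_val_zero, Matrix.cons_val_one] at h
  have h3 := h.trans_le (Nat.mul_le_mul_left _ (by simpa only [Fin.forall_fin_two] using h2))
  have h4 : Fintype.card F ≤ Fintype.card F ^ Module.finrank F V :=
    Nat.le_self_pow (by lia) _
  have h5 : 1 ≤ Fintype.card F ^ Module.finrank F V := Nat.one_le_pow _ _ Fintype.card_pos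
  have h6 := Nat.cast_le (α := ℝ).mpr h3
  push_cast [Nat.cast_sub h4, Nat.cast_sub h5] at h6
  exact h6

open Classical in
theorem card_filter_exists_linearCombination_mem_mul_le [Fintype F] [Fintype V]
    (hV : 1 ≤ Module.finrank F V) {k : ℕ} {B : Finset V} (hB : 0 ∉ B)
    [DecidablePred fun M : Fin k → V => ∃ b, Fintype.linearCombination F M b ∈ B] :
    (((linIndepFamilies F V k).filter fun M => ∃ b, Fintype.linearCombination F M b ∈ B).card : ℝ) *
        ((Fintype.card F : ℝ) ^ Module.finrank F V - 1) ≤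
      ((Fintype.card F : ℝ) ^ k - 1) * ((linIndepFamilies F V k).card * B.card) := by
  have hq : (1 : ℝ) ≤ (Fintype.card F : ℝ) ^ Module.finrank F V :=
    one_le_pow₀ (by exact_mod_cast Fintype.card_pos (α := F))
  have h1 : ((linIndepFamilies F V k).filter fun M => ∃ b, Fintype.linearCombination F M b ∈ B) ⊆
      (Finset.univ.erase (0 : Fin k → F)).biUnion fun b =>
        (linIndepFamilies F V k).filter fun M => Fintype.linearCombination F M b ∈ B := by
    intro M hM
    obtain ⟨hM, b, hb⟩ := Finset.mem_filter.mp hM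
    refine Finset.mem_biUnion.mpr ⟨b, ?_, Finset.mem_filter.mpr ⟨hM, hb⟩⟩
    refine Finset.mem_erase.mpr ⟨?_, Finset.mem_univ _⟩
    rintro rfl
    exact hB (by simpa using hb)
  have h2 := Nat.cast_le (α := ℝ).mpr ((Finset.card_le_card h1).trans Finset.card_biUnion_le)
  push_cast at h2
  refine (mul_le_mul_of_nonneg_right h2 (by linarith)).trans ?_
  rw [Finset.sum_mul, Finset.sum_congr rfl fun b hb =>
    card_filter_linearCombination_mem hV (Finset.ne_of_mem_erase hb) hB]
  rw [Finset.sum_const, Finset.card_erase_of_mem (Finset.mem_univ _), Finset.card_univ, nsmul_eq_mul]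
  simp [Nat.cast_sub (Nat.one_le_pow _ _ (Fintype.card_pos (α := F)))]

theorem card_filter_not_linearIndependent_pair [Fintype F] [DecidableEq F] {k : ℕ} {b : Fin k → F}
    (hb : b ≠ 0) [DecidablePred fun b' => LinearIndependent F ![b, b']] :
    (Finset.univ.filter fun b' => ¬ LinearIndependent F ![b, b']).card = Fintype.card F := by
  have : (Finset.univ.filter fun b' => ¬ LinearIndependent F ![b, b']) =
      Finset.univ.image fun c : F => c • b := by
    ext b'
    simp [LinearIndependent.pair_iff' hb]
  rw [this, Finset.card_image_of_injective _ (smul_left_injective F hb), Finset.card_univ]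

open Classical in
theorem card_filter_forall_linearCombination_notMem_mul_le [Fintype F] [Fintype V] {k : ℕ}
    (hk : 1 ≤ k) (hkV : k < Module.finrank F V) {B : Finset V} (hB : 0 ∉ B)
    [DecidablePred fun M : Fin k → V => ∀ b, Fintype.linearCombination F M b ∉ B] :
    (((linIndepFamilies F V k).filter fun M =>
        ∀ b, Fintype.linearCombination F M b ∉ B).card : ℝ) *
        (((Fintype.card F : ℝ) ^ k - 1) * B.card / ((Fintype.card F : ℝ) ^ Module.finrank F V - 1)) ≤
      Fintype.card F * (linIndepFamilies F V k).card := by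
  set S := linIndepFamilies F V k
  set q : ℝ := (Fintype.card F : ℝ)
  set n := Module.finrank F V
  set μ : ℝ := (q ^ k - 1) * B.card / (q ^ n - 1) with hμ_def
  have hq : 1 < q := Nat.one_lt_cast.mpr Fintype.one_lt_card
  have hqk : q ≤ q ^ k := le_self_pow₀ hq.le (by lia)
  have hkn : q ^ k < q ^ n := pow_lt_pow_right₀ hq hkV
  let N1 : (Fin k → F) → ℝ := fun b => (S.filter fun M => Fintype.linearCombination F M b ∈ B).card
  have hN1 : ∀ b, b ≠ 0 → N1 b = S.card * B.card / (q ^ n - 1) := by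
    intro b hb
    rw [eq_div_iff (by linarith)]
    exact card_filter_linearCombination_mem (by lia) hb hB
  have hN10 : N1 0 = 0 := by simp [N1, hB]
  let X : (Fin k → V) → ℝ := fun M =>
    ∑ b : Fin k → F, if Fintype.linearCombination F M b ∈ B then 1 else 0
  have hcard0 : ((Finset.univ.erase (0 : Fin k → F)).card : ℝ) = q ^ k - 1 := by
    rw [Finset.card_erase_of_mem (Finset.mem_univ _), Finset.card_univ]
    simp [Nat.cast_sub (Nat.one_le_pow _ _ (Fintype.card_pos (α := F))), q]
  have hX1 : ∑ M ∈ S, X M = S.card * μ := by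
    have : ∑ M ∈ S, X M = ∑ b, N1 b := by
      rw [Finset.sum_comm]
      simp [N1]
    rw [this, ← Finset.sum_erase _ hN10, Finset.sum_congr rfl fun b hb =>
      hN1 b (Finset.ne_of_mem_erase hb), Finset.sum_const, nsmul_eq_mul, hcard0, hμ_def]
    ring
  have hX2 : ∑ M ∈ S, X M ^ 2 ≤ S.card * μ ^ 2 + q * (S.card * μ) := by
    let N2 : (Fin k → F) → (Fin k → F) → ℝ := fun b b' =>
      (S.filter fun M => Fintype.linearCombination F M b ∈ B ∧
        Fintype.linearCombination F M b' ∈ B).card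
    have h1 : ∑ M ∈ S, X M ^ 2 = ∑ b, ∑ b', N2 b b' := by
      simp only [X, sq, Finset.sum_mul_sum]
      rw [Finset.sum_comm]
      refine Finset.sum_congr rfl fun b _ => ?_
      rw [Finset.sum_comm]
      refine Finset.sum_congr rfl fun b' _ => ?_
      simp only [N2, Finset.card_filter, Nat.cast_sum, ite_and]
      refine Finset.sum_congr rfl fun M _ => ?_
      split_ifs <;> simp
    have hN2 : ∀ b b', N2 b b' ≤ N1 b := fun b b' =>
      Nat.cast_le.mpr (Finset.card_le_card
        (Finset.monotone_filter_right _ fun M _ h => h.1))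
    have h20 : ∑ b', N2 0 b' = 0 := by simp [N2, hB]
    have h2 : ∀ b, b ≠ 0 → ∑ b', N2 b b' ≤
        S.card * (q ^ k - 1) * (B.card : ℝ) ^ 2 / (q ^ n - 1) ^ 2 +
          q * (S.card * B.card / (q ^ n - 1)) := by
      intro b hb
      have hc := card_filter_not_linearIndependent_pair hb
      have hc' : ((Finset.univ.filter fun b' => LinearIndependent F ![b, b']).card : ℝ) =
          q ^ k - q := by
        have := Finset.card_filter_add_card_filter_not (s := Finset.univ)
          (fun b' : Fin k → F => LinearIndependent F ![b, b'])
        rw [hc, Finset.card_univ, Fintype.card_fun, Fintype.card_fin] at this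
        have := congrArg (Nat.cast (R := ℝ)) this
        push_cast at this
        linarith
      rw [← Finset.sum_filter_add_sum_filter_not _ (fun b' => LinearIndependent F ![b, b'])]
      refine add_le_add ?_ ?_
      · have hle : ∀ b' ∈ Finset.univ.filter (fun b' => LinearIndependent F ![b, b']),
            N2 b b' ≤ S.card * (B.card : ℝ) ^ 2 / ((q ^ n - 1) * (q ^ n - q)) := by
          intro b' hb'
          rw [le_div_iff₀ (mul_pos (by linarith) (by linarith))]
          exact card_filter_linearCombination_mem_pair_le (by lia) (Finset.mem_filter.mp hb').2 B
        refine (Finset.sum_le_card_nsmul _ _ _ hle).trans ?_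
        rw [nsmul_eq_mul, hc']
        have hfrac : (q ^ k - q) / (q ^ n - q) ≤ (q ^ k - 1) / (q ^ n - 1) := by
          rw [div_le_div_iff₀ (by linarith) (by linarith)]
          nlinarith
        have hnn : 0 ≤ S.card * (B.card : ℝ) ^ 2 / (q ^ n - 1) :=
          div_nonneg (by positivity) (by linarith)
        have := mul_le_mul_of_nonneg_left hfrac hnn
        have ha : q ^ n - 1 ≠ 0 := by linarith
        have hb : q ^ n - q ≠ 0 := by linarith
        convert! this using 1 <;> field_simp
      · refine (Finset.sum_le_card_nsmul _ _ _ fun b' _ => (hN2 b b').trans (hN1 b hb).le).trans ?_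
        rw [hc, nsmul_eq_mul]
    rw [h1, ← Finset.sum_erase (f := fun b => ∑ b', N2 b b') _ h20]
    refine (Finset.sum_le_card_nsmul _ _ _ fun b hb => h2 b (Finset.ne_of_mem_erase hb)).trans ?_
    rw [nsmul_eq_mul, hcard0, hμ_def, div_pow]
    apply le_of_eq
    ring
  have hμ : 0 ≤ μ := div_nonneg (mul_nonneg (by linarith) (by positivity)) (by linarith)
  have hvar : ∑ M ∈ S, (X M - μ) ^ 2 ≤ q * (S.card * μ) := by
    have : ∑ M ∈ S, (X M - μ) ^ 2 = ∑ M ∈ S, X M ^ 2 - 2 * μ * ∑ M ∈ S, X M + S.card * μ ^ 2 := by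
      rw [Finset.mul_sum, ← Finset.sum_sub_distrib, ← nsmul_eq_mul, ← Finset.sum_const,
        ← Finset.sum_add_distrib]
      exact Finset.sum_congr rfl fun M _ => by ring
    rw [this, hX1]
    linarith
  have hgood : ((S.filter fun M => ∀ b, Fintype.linearCombination F M b ∉ B).card : ℝ) * μ ^ 2 ≤
      ∑ M ∈ S, (X M - μ) ^ 2 := by
    rw [← nsmul_eq_mul, ← Finset.sum_const]
    refine le_trans (Finset.sum_le_sum fun M hM => ?_)
      (Finset.sum_le_sum_of_subset_of_nonneg (Finset.filter_subset _ S) fun M _ _ => sq_nonneg _)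
    have : X M = 0 := Finset.sum_eq_zero fun b _ => if_neg ((Finset.mem_filter.mp hM).2 b)
    rw [this]
    apply le_of_eq
    ring
  rcases hμ.eq_or_lt with h | h
  · rw [← h, mul_zero]
    exact mul_nonneg (by linarith) (Nat.cast_nonneg _)
  · refine le_of_mul_le_mul_right ?_ h
    linarith [hgood.trans hvar]

end RandomFamily

section HammingBall

theorem card_hammingNorm_eq (F : Type*) [Zero F] [Fintype F] [DecidableEq F] (n i : ℕ) :
    (Finset.univ.filter fun v : Fin n → F => hammingNorm v = i).card =
      n.choose i * (Fintype.card F - 1) ^ i := by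
  have hsupp : ∀ s : Finset (Fin n),
      (Finset.univ.filter fun v : Fin n → F => (Finset.univ.filter fun j => v j ≠ 0) = s).card =
        (Fintype.card F - 1) ^ s.card := by
    intro s
    have : (Finset.univ.filter fun v : Fin n → F =>
        (Finset.univ.filter fun j => v j ≠ 0) = s) =
        Fintype.piFinset fun j => if j ∈ s then Finset.univ.erase (0 : F) else {0} := by
      ext v
      simp only [Finset.mem_filter, Finset.mem_univ, true_and, Fintype.mem_piFinset,
        Finset.ext_iff]
      refine forall_congr' fun j => ?_
      by_cases hj : j ∈ s <;> simp [hj]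
    rw [this, Fintype.card_piFinset]
    simp only [apply_ite Finset.card, Finset.card_erase_of_mem (Finset.mem_univ _),
      Finset.card_univ, Finset.card_singleton, Finset.prod_ite_mem, Finset.univ_inter,
      Finset.prod_const]
  rw [Finset.card_eq_sum_card_fiberwise (t := Finset.univ.powersetCard i)
    (f := fun v : Fin n → F => Finset.univ.filter fun j => v j ≠ 0)]
  · rw [Finset.sum_congr rfl (g := fun _ => (Fintype.card F - 1) ^ i)]
    · simp
    · intro s hs
      have hs := (Finset.mem_powersetCard.mp hs).2
      rw [← hs, ← hsupp s, Finset.filter_filter]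
      congr 1
      ext v
      simp only [Finset.mem_filter, Finset.mem_univ, true_and, and_iff_right_iff_imp]
      rintro rfl
      rfl
  · intro v hv
    simp only [Finset.coe_filter, Finset.mem_univ, true_and, Set.mem_ofPred_eq] at hv
    exact Finset.mem_coe.mpr (Finset.mem_powersetCard.mpr ⟨Finset.subset_univ _, hv⟩)

/-- The probability of the word `v` when its letters are independent, each being nonzero with
probability `x` and then uniformly distributed on the nonzero letters. -/
noncomputable def wordProb {F : Type*} [Zero F] [Fintype F] [DecidableEq F] {n : ℕ} (x : ℝ)
    (v : Fin n → F) : ℝ :=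
  x ^ hammingNorm v * (1 - x) ^ (n - hammingNorm v) / ((Fintype.card F : ℝ) - 1) ^ hammingNorm v

variable {F : Type*} [Zero F] [Fintype F] [DecidableEq F]

theorem sum_mul_wordProb [Nontrivial F] (n : ℕ) (x : unitInterval) (g : ℕ → ℝ) :
    ∑ v : Fin n → F, g (hammingNorm v) * wordProb x v =
      ∑ i : Fin (n + 1), g i * bernstein n i x := by
  have hq : (1 : ℝ) < Fintype.card F := Nat.one_lt_cast.mpr Fintype.one_lt_card
  rw [Fin.sum_univ_eq_sum_range fun i => g i * bernstein n i x,
    ← Finset.sum_fiberwise_of_maps_to (t := Finset.range (n + 1))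
      (g := fun v : Fin n → F => hammingNorm v)]
  · refine Finset.sum_congr rfl fun i _ => ?_
    have hc : ∀ v ∈ Finset.univ.filter (fun v : Fin n → F => hammingNorm v = i),
        g (hammingNorm v) * wordProb x v =
          g i * ((x : ℝ) ^ i * (1 - x) ^ (n - i) / ((Fintype.card F : ℝ) - 1) ^ i) := by
      intro v hv
      rw [wordProb, (Finset.mem_filter.mp hv).2]
    rw [Finset.sum_congr rfl hc, Finset.sum_const, card_hammingNorm_eq, nsmul_eq_mul,
      bernstein_apply]
    have h0 : (Fintype.card F : ℝ) - 1 ≠ 0 := by linarith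
    push_cast [Nat.cast_sub Fintype.one_lt_card.le]
    field_simp
  · intro v _
    have : hammingNorm v ≤ n := by simpa using hammingNorm_le_card_fintype (x := v)
    exact Finset.mem_range.mpr (by lia)

theorem sum_wordProb [Nontrivial F] (n : ℕ) (x : unitInterval) :
    ∑ v : Fin n → F, wordProb x v = 1 := by
  simpa using sum_mul_wordProb (F := F) n x fun _ => 1

theorem sum_sq_mul_wordProb [Nontrivial F] {n : ℕ} (hn : n ≠ 0) (x : unitInterval) :
    ∑ v : Fin n → F, ((x : ℝ) - hammingNorm v / n) ^ 2 * wordProb x v = x * (1 - x) / n := by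
  rw [sum_mul_wordProb (F := F) n x fun i => ((x : ℝ) - i / n) ^ 2]
  exact bernstein.variance hn x

theorem wordProb_eq_rpow [Nontrivial F] {n : ℕ} {x : ℝ} (hx0 : 0 < x) (hx1 : x < 1)
    (v : Fin n → F) :
    wordProb x v = (Fintype.card F : ℝ) ^ (n * Real.logb (Fintype.card F) (1 - x) +
      hammingNorm v * Real.logb (Fintype.card F) (x / (((Fintype.card F : ℝ) - 1) * (1 - x)))) := by
  have hq : (1 : ℝ) < Fintype.card F := Nat.one_lt_cast.mpr Fintype.one_lt_card
  have hw : hammingNorm v ≤ n := by simpa using hammingNorm_le_card_fintype (x := v)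
  have h1 : 0 < 1 - x := by linarith
  have h2 : 0 < (Fintype.card F : ℝ) - 1 := by linarith
  rw [Real.rpow_add (by linarith), mul_comm (n : ℝ), mul_comm (hammingNorm v : ℝ),
    Real.rpow_mul (by linarith), Real.rpow_mul (by linarith),
    Real.rpow_logb (by linarith) hq.ne' h1, Real.rpow_logb (by linarith) hq.ne' (by positivity),
    Real.rpow_natCast, Real.rpow_natCast, wordProb]
  obtain ⟨m, hm⟩ := Nat.exists_eq_add_of_le hw
  generalize hammingNorm v = w at *
  subst hm
  rw [Nat.add_sub_cancel_left, div_pow, mul_pow, pow_add]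
  field_simp

theorem wordProb_nonneg {n : ℕ} (x : unitInterval) [Nontrivial F] (v : Fin n → F) :
    0 ≤ wordProb x v := by
  have hq : (1 : ℝ) < Fintype.card F := Nat.one_lt_cast.mpr Fintype.one_lt_card
  have h0 := x.2.1
  have h1 := x.2.2
  exact div_nonneg (mul_nonneg (pow_nonneg h0 _) (pow_nonneg (by linarith) _))
    (pow_nonneg (by linarith) _)

theorem logb_ratio_nonpos {q x : ℝ} (hq : 1 < q) (hx0 : 0 < x) (hx1 : x < 1 - 1 / q) :
    Real.logb q (x / ((q - 1) * (1 - x))) ≤ 0 := by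
  have hq0 : 0 < q := by linarith
  have h1 : 1 / q < 1 - x := by linarith
  have h2 : 0 < 1 - x := lt_trans (by positivity) h1
  have h3 : 0 < (q - 1) * (1 - x) := mul_pos (by linarith) h2
  refine Real.logb_nonpos hq (by positivity) ?_
  rw [div_le_one h3]
  rw [div_lt_iff₀ hq0] at h1
  nlinarith

theorem qEntropy_eq_neg {q : ℕ} {x : ℝ} (hq : 1 < q) (hx0 : 0 < x) (hx1 : x < 1) :
    qEntropy q x = -(Real.logb q (1 - x) + x * Real.logb q (x / (((q : ℝ) - 1) * (1 - x)))) := by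
  have hq' : (1 : ℝ) < q := by exact_mod_cast hq
  rw [qEntropy, Real.logb_div hx0.ne' (mul_pos (by linarith) (by linarith)).ne',
    Real.logb_mul (by linarith) (by linarith)]
  ring

/-- The nonzero words of weight at most `δn`. -/
noncomputable def puncturedBall (F : Type*) [Zero F] [Fintype F] [DecidableEq F] (δ : ℝ) (n : ℕ) :
    Finset (Fin n → F) :=
  Finset.univ.filter fun v => v ≠ 0 ∧ (hammingNorm v : ℝ) ≤ δ * n

theorem card_puncturedBall_le [Nontrivial F] {δ : ℝ} (hδ0 : 0 < δ)
    (hδ1 : δ < 1 - 1 / (Fintype.card F : ℝ)) (n : ℕ) :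
    ((puncturedBall F δ n).card : ℝ) ≤
      (Fintype.card F : ℝ) ^ (qEntropy (Fintype.card F) δ * n) := by
  have hq : (1 : ℝ) < Fintype.card F := Nat.one_lt_cast.mpr Fintype.one_lt_card
  have hδ : δ < 1 := hδ1.trans (by
    have : 0 < 1 / (Fintype.card F : ℝ) := by positivity
    linarith)
  have hL := logb_ratio_nonpos hq hδ0 hδ1
  have hh := qEntropy_eq_neg Fintype.one_lt_card hδ0 hδ (q := Fintype.card F)
  have hle : ∀ v ∈ puncturedBall F δ n,
      (Fintype.card F : ℝ) ^ (-(qEntropy (Fintype.card F) δ * n)) ≤ wordProb δ v := by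
    intro v hv
    have hv := (Finset.mem_filter.mp hv).2.2
    rw [wordProb_eq_rpow hδ0 hδ]
    refine Real.rpow_le_rpow_of_exponent_le hq.le ?_
    rw [hh]
    nlinarith
  have hsum := Finset.card_nsmul_le_sum _ _ _ hle
  have htot : ∑ v ∈ puncturedBall F δ n, wordProb δ v ≤ 1 := by
    rw [← sum_wordProb (F := F) n ⟨δ, hδ0.le, hδ.le⟩]
    exact Finset.sum_le_sum_of_subset_of_nonneg (Finset.subset_univ _)
      fun v _ _ => wordProb_nonneg ⟨δ, hδ0.le, hδ.le⟩ v
  rw [nsmul_eq_mul, Real.rpow_neg (by linarith)] at hsum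
  have := hsum.trans htot
  rwa [← div_eq_mul_inv, div_le_one (Real.rpow_pos_of_pos (by linarith) _)] at this

theorem half_rpow_le_card_puncturedBall [Nontrivial F] {δ ε : ℝ} (hε : 0 < ε) (hεδ : 2 * ε ≤ δ)
    (hδ1 : δ < 1 - 1 / (Fintype.card F : ℝ)) {n : ℕ} (hn : 2 ≤ n * ε ^ 2) :
    (Fintype.card F : ℝ) ^ (-(Real.logb (Fintype.card F) (1 - (δ - ε)) + (δ - 2 * ε) *
      Real.logb (Fintype.card F) ((δ - ε) / (((Fintype.card F : ℝ) - 1) * (1 - (δ - ε))))) * n) / 2 ≤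
    (puncturedBall F δ n).card := by
  have hq : (1 : ℝ) < Fintype.card F := Nat.one_lt_cast.mpr Fintype.one_lt_card
  set x := δ - ε with hx
  have hx0 : 0 < x := by linarith
  have hx1' : x < 1 - 1 / (Fintype.card F : ℝ) := by linarith
  have hx1 : x < 1 := hx1'.trans (by
    have : 0 < 1 / (Fintype.card F : ℝ) := by positivity
    linarith)
  have hL := logb_ratio_nonpos hq hx0 hx1'
  have hn0 : n ≠ 0 := by
    rintro rfl
    norm_num at hn
  have hn0' : (0 : ℝ) < n := by positivity
  set y : unitInterval := ⟨x, hx0.le, hx1.le⟩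
  set c := Real.logb (Fintype.card F) (1 - x) + (δ - 2 * ε) *
    Real.logb (Fintype.card F) (x / (((Fintype.card F : ℝ) - 1) * (1 - x)))
  let A := Finset.univ.filter fun v : Fin n → F => |x - hammingNorm v / n| < ε
  have hAB : A ⊆ puncturedBall F δ n := by
    intro v hv
    have hv := abs_lt.mp (Finset.mem_filter.mp hv).2
    refine Finset.mem_filter.mpr ⟨Finset.mem_univ _, ?_, ?_⟩
    · rintro rfl
      simp at hv
      linarith
    · rw [← div_le_iff₀ hn0']
      linarith
  have hA : ∀ v ∈ A, wordProb x v ≤ (Fintype.card F : ℝ) ^ (c * n) := by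
    intro v hv
    have hv := abs_lt.mp (Finset.mem_filter.mp hv).2
    rw [wordProb_eq_rpow hx0 hx1]
    refine Real.rpow_le_rpow_of_exponent_le hq.le ?_
    have : (δ - 2 * ε) * n ≤ hammingNorm v := by
      rw [← le_div_iff₀ hn0']
      linarith
    nlinarith
  have hcompl : ε ^ 2 * ∑ v ∈ Finset.univ.filter (fun v : Fin n → F =>
      ¬ |x - hammingNorm v / n| < ε), wordProb x v ≤ 1 / n := by
    calc _ ≤ ∑ v : Fin n → F, (x - hammingNorm v / n) ^ 2 * wordProb x v := by
          rw [Finset.mul_sum]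
          refine le_trans (Finset.sum_le_sum fun v hv => ?_)
            (Finset.sum_le_sum_of_subset_of_nonneg (Finset.filter_subset _ _) fun v _ _ =>
              mul_nonneg (sq_nonneg _) (wordProb_nonneg y v))
          refine mul_le_mul_of_nonneg_right ?_ (wordProb_nonneg y v)
          rw [← sq_abs (x - _)]
          exact pow_le_pow_left₀ hε.le (not_lt.mp (Finset.mem_filter.mp hv).2) 2
      _ = x * (1 - x) / n := sum_sq_mul_wordProb hn0 y
      _ ≤ 1 / n := by
          gcongr
          nlinarith
  have htot := Finset.sum_filter_add_sum_filter_not Finset.univ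
    (fun v : Fin n → F => |x - hammingNorm v / n| < ε) (fun v => wordProb x v)
  rw [sum_wordProb n y] at htot
  have hhalf : ∑ v ∈ Finset.univ.filter (fun v : Fin n → F =>
      ¬ |x - hammingNorm v / n| < ε), wordProb x v ≤ 1 / 2 := by
    rw [le_div_iff₀ hn0'] at hcompl
    have h0 : 0 ≤ ∑ v ∈ Finset.univ.filter (fun v : Fin n → F =>
      ¬ |x - hammingNorm v / n| < ε), wordProb x v :=
      Finset.sum_nonneg fun v _ => wordProb_nonneg y v
    nlinarith
  have hsum := Finset.sum_le_card_nsmul _ _ _ hA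
  rw [nsmul_eq_mul] at hsum
  have hcard : (A.card : ℝ) ≤ (puncturedBall F δ n).card :=
    Nat.cast_le.mpr (Finset.card_le_card hAB)
  refine le_trans ?_ hcard
  have hpos : 0 < (Fintype.card F : ℝ) ^ (c * n) := Real.rpow_pos_of_pos (by linarith) _
  rw [neg_mul, Real.rpow_neg (by linarith), div_le_iff₀ two_pos, inv_le_iff_one_le_mul₀ hpos]
  linarith

theorem eventually_half_rpow_le_card_puncturedBall [Nontrivial F] {δ η : ℝ} (hδ0 : 0 < δ)
    (hδ1 : δ < 1 - 1 / (Fintype.card F : ℝ)) (hη : η < qEntropy (Fintype.card F) δ) :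
    ∀ᶠ n : ℕ in Filter.atTop,
      (Fintype.card F : ℝ) ^ (η * n) / 2 ≤ (puncturedBall F δ n).card := by
  have hq : (1 : ℝ) < Fintype.card F := Nat.one_lt_cast.mpr Fintype.one_lt_card
  have hδ : δ < 1 := hδ1.trans (by
    have : 0 < 1 / (Fintype.card F : ℝ) := by positivity
    linarith)
  have hcont : ContinuousAt (fun ε : ℝ => -(Real.logb (Fintype.card F) (1 - (δ - ε)) +
      (δ - 2 * ε) * Real.logb (Fintype.card F)
        ((δ - ε) / (((Fintype.card F : ℝ) - 1) * (1 - (δ - ε)))))) 0 := by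
    have h1 : 1 - (δ - 0) ≠ 0 := by linarith
    have h2 : ((Fintype.card F : ℝ) - 1) * (1 - (δ - 0)) ≠ 0 :=
      mul_ne_zero (by linarith) h1
    have h3 : (δ - 0) / (((Fintype.card F : ℝ) - 1) * (1 - (δ - 0))) ≠ 0 :=
      div_ne_zero (by linarith) h2
    simp only [Real.logb]
    fun_prop (disch := assumption)
  have hlt : η < -(Real.logb (Fintype.card F) (1 - (δ - 0)) +
      (δ - 2 * 0) * Real.logb (Fintype.card F)
        ((δ - 0) / (((Fintype.card F : ℝ) - 1) * (1 - (δ - 0))))) := by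
    simpa only [sub_zero, mul_zero, ← qEntropy_eq_neg Fintype.one_lt_card hδ0 hδ] using hη
  have hev := hcont.eventually (lt_mem_nhds hlt)
  obtain ⟨ε, ⟨hε, hεδ⟩, hε0⟩ := (((hev.filter_mono nhdsWithin_le_nhds).and
    ((ge_mem_nhds (show (0 : ℝ) < δ / 2 by linarith)).filter_mono nhdsWithin_le_nhds)).and
    (self_mem_nhdsWithin (s := Set.Ioi (0 : ℝ)))).exists
  have hlarge : ∀ᶠ n : ℕ in Filter.atTop, 2 ≤ n * ε ^ 2 :=
    (tendsto_natCast_atTop_atTop.atTop_mul_const (pow_pos hε0 2)).eventually_ge_atTop 2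
  filter_upwards [hlarge] with n hn
  refine le_trans ?_ (half_rpow_le_card_puncturedBall hε0 (by linarith) hδ1 hn)
  gcongr
  · exact hq.le

end HammingBall

section PhaseTransition

variable {F : Type} [Field F]

theorem Matrix.rank_eq_height_iff_linearIndependent {k n : ℕ} (M : Matrix (Fin k) (Fin n) F) :
    M.rank = k ↔ LinearIndependent F (fun i => M i) := by
  constructor
  · intro h
    refine linearIndependent_iff_card_eq_finrank_span.mpr ?_
    rw [Fintype.card_fin, Set.finrank]
    exact h.symm.trans M.rank_eq_finrank_span_row
  · intro h
    simpa using LinearIndependent.rank_matrix (M := M) h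

theorem Matrix.vecMul_eq_linearCombination {k n : ℕ} (M : Matrix (Fin k) (Fin n) F)
    (b : Fin k → F) :
    Matrix.vecMul b M = Fintype.linearCombination F (fun i => M i) b := by
  ext j
  simp [Matrix.vecMul, dotProduct, Fintype.linearCombination_apply]

variable [Fintype F]

theorem card_linIndepFamilies_pos {k n : ℕ} (hk : k ≤ n) :
    0 < (linIndepFamilies F (Fin n → F) k).card := by
  rw [card_linIndepFamilies (by simpa using hk)]
  refine Finset.prod_pos fun i _ => Nat.sub_pos_of_lt ?_
  rw [Module.finrank_fin_fun]
  exact Nat.pow_lt_pow_right Fintype.one_lt_card (by lia)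

variable [DecidableEq F]

open Classical in
theorem Qlin_eq_card_div_card (r δ : ℝ) (n : ℕ) :
    Qlin F r δ n =
      (((linIndepFamilies F (Fin n → F) ⌊r * (n : ℝ)⌋₊).filter fun M =>
        ∀ b, Fintype.linearCombination F M b ∉ puncturedBall F δ n).card : ℝ) /
      (linIndepFamilies F (Fin n → F) ⌊r * (n : ℝ)⌋₊).card := by
  rw [Qlin, ← Set.ncard_coe_finset, ← Set.ncard_coe_finset]
  congr 3
  · have hmem : ∀ M : Fin ⌊r * (n : ℝ)⌋₊ → Fin n → F,
        ((Matrix.of M).rank = ⌊r * (n : ℝ)⌋₊ ∧ ∀ b, Matrix.vecMul b (Matrix.of M) ≠ 0 →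
          δ * n < (hammingNorm (Matrix.vecMul b (Matrix.of M)) : ℝ)) ↔
        M ∈ (linIndepFamilies F (Fin n → F) ⌊r * (n : ℝ)⌋₊).filter fun M =>
          ∀ b, Fintype.linearCombination F M b ∉ puncturedBall F δ n := by
      intro M
      rw [Finset.mem_filter]
      refine and_congr ?_ (forall_congr' fun b => ?_)
      · exact (Matrix.rank_eq_height_iff_linearIndependent (Matrix.of M)).trans
          mem_linIndepFamilies.symm
      · rw [Matrix.vecMul_eq_linearCombination]
        change (Fintype.linearCombination F M b ≠ 0 →
          δ * n < (hammingNorm (Fintype.linearCombination F M b) : ℝ)) ↔ _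
        simp [puncturedBall]
    exact Set.ext hmem
  · exact Set.ext fun M => (Matrix.rank_eq_height_iff_linearIndependent M).trans
      mem_linIndepFamilies.symm

theorem zero_notMem_puncturedBall (δ : ℝ) (n : ℕ) : (0 : Fin n → F) ∉ puncturedBall F δ n := by
  simp [puncturedBall]

theorem Qlin_nonneg (r δ : ℝ) (n : ℕ) : 0 ≤ Qlin F r δ n :=
  div_nonneg (Nat.cast_nonneg _) (Nat.cast_nonneg _)

theorem Qlin_le_one (r δ : ℝ) (n : ℕ) : Qlin F r δ n ≤ 1 := by
  classical
  rw [Qlin_eq_card_div_card]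
  exact div_le_one_of_le₀ (Nat.cast_le.mpr (Finset.card_le_card (Finset.filter_subset _ _)))
    (Nat.cast_nonneg _)

theorem one_sub_rpow_le_Qlin {r δ : ℝ} (hr0 : 0 < r) (hr1 : r < 1) (hδ0 : 0 < δ)
    (hδ1 : δ < 1 - 1 / (Fintype.card F : ℝ)) {n : ℕ} (hn : 1 ≤ n) :
    1 - (Fintype.card F : ℝ) ^ ((r - gvBound (Fintype.card F) δ) * n) ≤ Qlin F r δ n := by
  classical
  have hq : (1 : ℝ) < Fintype.card F := Nat.one_lt_cast.mpr Fintype.one_lt_card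
  have hkr : (⌊r * (n : ℝ)⌋₊ : ℝ) ≤ r * n := Nat.floor_le (by positivity)
  have hn' : (1 : ℝ) ≤ n := by exact_mod_cast hn
  have hkn : ⌊r * (n : ℝ)⌋₊ ≤ n := by
    rw [← Nat.cast_le (α := ℝ)]
    nlinarith
  rw [Qlin_eq_card_div_card]
  generalize ⌊r * (n : ℝ)⌋₊ = k at *
  have hS := Nat.cast_pos (α := ℝ).mpr (card_linIndepFamilies_pos (F := F) hkn)
  have h1 := card_filter_exists_linearCombination_mem_mul_le (F := F) (V := Fin n → F) (k := k)
    (by simpa using hn) (zero_notMem_puncturedBall δ n)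
  have h2 : (((linIndepFamilies F (Fin n → F) k).filter fun M =>
        ∀ b, Fintype.linearCombination F M b ∉ puncturedBall F δ n).card : ℝ) +
      ((linIndepFamilies F (Fin n → F) k).filter fun M =>
        ∃ b, Fintype.linearCombination F M b ∈ puncturedBall F δ n).card =
      (linIndepFamilies F (Fin n → F) k).card := by
    rw [← Nat.cast_add, Nat.cast_inj, ← Finset.card_filter_add_card_filter_not
      (s := linIndepFamilies F (Fin n → F) k)
      (fun M => ∀ b, Fintype.linearCombination F M b ∉ puncturedBall F δ n)]
    congr 1
    exact congrArg Finset.card (Finset.filter_congr fun M _ => by simp)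
  rw [Module.finrank_fin_fun] at h1
  have hB := card_puncturedBall_le hδ0 hδ1 n
  set q : ℝ := (Fintype.card F : ℝ)
  set S : ℝ := ((linIndepFamilies F (Fin n → F) k).card : ℝ)
  set B : ℝ := ((puncturedBall F δ n).card : ℝ)
  have hB0 : 0 ≤ B := Nat.cast_nonneg _
  have hqn : 1 < q ^ n := one_lt_pow₀ hq (by lia)
  have hqkn : q ^ k ≤ q ^ n := pow_le_pow_right₀ hq.le hkn
  have hfrac : (q ^ k - 1) / (q ^ n - 1) ≤ q ^ k / q ^ n := by
    rw [div_le_div_iff₀ (by linarith) (by linarith)]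
    linarith
  have hpow : q ^ k / q ^ n * B ≤ q ^ ((r - gvBound (Fintype.card F) δ) * n) := by
    calc q ^ k / q ^ n * B ≤
        q ^ (r * n) / q ^ (n : ℝ) * q ^ (qEntropy (Fintype.card F) δ * n) := by
          rw [← Real.rpow_natCast q k, ← Real.rpow_natCast q n]
          gcongr
          exact hq.le
      _ = q ^ ((r - gvBound (Fintype.card F) δ) * n) := by
          rw [← Real.rpow_sub (by linarith), ← Real.rpow_add (by linarith), gvBound]
          congr 1
          ring
  rw [le_div_iff₀ hS]
  rw [← le_div_iff₀ (by linarith)] at h1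
  have h3 : (q ^ k - 1) * (S * B) / (q ^ n - 1) = S * ((q ^ k - 1) / (q ^ n - 1) * B) := by ring
  rw [h3] at h1
  have h4 := mul_le_mul_of_nonneg_left
    ((mul_le_mul_of_nonneg_right hfrac hB0).trans hpow) hS.le
  linarith

theorem Qlin_le_rpow {r δ η : ℝ} (hr1 : r < 1) {n : ℕ} (hn : 1 ≤ r * n)
    (hB : (Fintype.card F : ℝ) ^ (η * n) / 2 ≤ (puncturedBall F δ n).card) :
    Qlin F r δ n ≤ 4 * (Fintype.card F : ℝ) ^ 2 * (Fintype.card F : ℝ) ^ ((1 - η - r) * n) := by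
  classical
  have hq : (1 : ℝ) < Fintype.card F := Nat.one_lt_cast.mpr Fintype.one_lt_card
  have hn0 : (0 : ℝ) < n := by
    rcases Nat.eq_zero_or_pos n with rfl | h
    · norm_num at hn
    · exact_mod_cast h
  have hk1 : 1 ≤ ⌊r * (n : ℝ)⌋₊ := Nat.one_le_floor_iff _ |>.mpr hn
  have hkr : (⌊r * (n : ℝ)⌋₊ : ℝ) ≤ r * n := Nat.floor_le (by linarith)
  have hkr' : r * n - 1 ≤ ⌊r * (n : ℝ)⌋₊ := (Nat.sub_one_lt_floor _).le
  have hkn : ⌊r * (n : ℝ)⌋₊ < n := by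
    rw [← Nat.cast_lt (α := ℝ)]
    nlinarith
  rw [Qlin_eq_card_div_card]
  generalize ⌊r * (n : ℝ)⌋₊ = k at *
  have hS := Nat.cast_pos (α := ℝ).mpr (card_linIndepFamilies_pos (F := F) hkn.le)
  have h1 := card_filter_forall_linearCombination_notMem_mul_le (F := F) (V := Fin n → F) hk1
    (by simpa using hkn) (zero_notMem_puncturedBall δ n)
  rw [Module.finrank_fin_fun] at h1
  have hq2 : (2 : ℝ) ≤ Fintype.card F := by exact_mod_cast Fintype.one_lt_card (α := F)
  set q : ℝ := (Fintype.card F : ℝ)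
  set S : ℝ := ((linIndepFamilies F (Fin n → F) k).card : ℝ)
  set B : ℝ := ((puncturedBall F δ n).card : ℝ)
  set G : ℝ := (((linIndepFamilies F (Fin n → F) k).filter fun M =>
    ∀ b, Fintype.linearCombination F M b ∉ puncturedBall F δ n).card : ℝ)
  have hG : 0 ≤ G := Nat.cast_nonneg _
  have hq0 : 0 < q := by linarith
  have hqk : q ≤ q ^ k := le_self_pow₀ hq.le (by lia)
  have hqkn : q ^ k < q ^ n := pow_lt_pow_right₀ hq hkn
  set T := q ^ ((1 - η - r) * n) with hT_def
  have hT : 0 < T := Real.rpow_pos_of_pos hq0 _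
  have hμ : 1 / (4 * q * T) ≤ (q ^ k - 1) * B / (q ^ n - 1) := by
    calc 1 / (4 * q * T) = (q ^ (r * n - 1) / 2) * (q ^ (η * n) / 2) / q ^ n := by
          have : (1 - η - r) * n = n - η * n - (r * n - 1) - 1 := by ring
          rw [hT_def, this, Real.rpow_sub hq0, Real.rpow_sub hq0, Real.rpow_sub hq0,
            Real.rpow_natCast, Real.rpow_one]
          have h1 := (Real.rpow_pos_of_pos hq0 (η * n)).ne'
          have h2 := (Real.rpow_pos_of_pos hq0 (r * n - 1)).ne'
          field_simp
          norm_num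
      _ ≤ (q ^ k - 1) * B / (q ^ n - 1) := by
          have hk : q ^ (r * n - 1) ≤ q ^ k := by
            rw [← Real.rpow_natCast q k]
            exact Real.rpow_le_rpow_of_exponent_le hq.le hkr'
          have hη : 0 < q ^ (η * n) := Real.rpow_pos_of_pos hq0 _
          refine div_le_div₀ (mul_nonneg (by linarith) (by linarith))
            (mul_le_mul (by linarith) hB (by linarith) (by linarith)) (by linarith) (by linarith)
  have h2 := (mul_le_mul_of_nonneg_left hμ hG).trans h1
  rw [div_le_iff₀ hS]
  rw [mul_one_div, div_le_iff₀ (by positivity)] at h2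
  linarith

theorem tendsto_rpow_mul_natCast_atTop_zero {q a : ℝ} (hq : 1 < q) (ha : a < 0) :
    Filter.Tendsto (fun n : ℕ => q ^ (a * n)) Filter.atTop (nhds 0) := by
  have h : ∀ n : ℕ, q ^ (a * n) = (q ^ a) ^ n := fun n => by
    rw [Real.rpow_mul (by linarith), Real.rpow_natCast]
  simp only [h]
  exact tendsto_pow_atTop_nhds_zero_of_lt_one (Real.rpow_nonneg (by linarith) _)
    (Real.rpow_lt_one_of_one_lt_of_neg hq ha)

end PhaseTransition

/-- the GV bound is a phase transition point for random linear codes of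
full rank `k = ⌊rn⌋`: the conditional probability that the relative minimum distance
exceeds `δ` given full rank tends to `1` if `r < g_q(δ)` and to `0` if `r > g_q(δ)`. -/
theorem statement3 (F : Type) [Field F] [Fintype F] [DecidableEq F]
    (q : ℕ) (hq : q = Fintype.card F) (r δ : ℝ) (hr0 : 0 < r) (hr1 : r < 1)
    (hδ0 : 0 < δ) (hδ1 : δ < 1 - 1 / (q : ℝ)) :
    (r < gvBound q δ →
      Filter.Tendsto (Qlin F r δ) Filter.atTop (nhds 1)) ∧
    (gvBound q δ < r →
      Filter.Tendsto (Qlin F r δ) Filter.atTop (nhds 0)) := by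
  subst hq
  have hq : (1 : ℝ) < Fintype.card F := Nat.one_lt_cast.mpr Fintype.one_lt_card
  constructor
  · intro hr
    have hlim := (tendsto_rpow_mul_natCast_atTop_zero hq (sub_neg.mpr hr)).const_sub 1
    rw [sub_zero] at hlim
    refine tendsto_of_tendsto_of_tendsto_of_le_of_le' hlim tendsto_const_nhds ?_
      (Filter.Eventually.of_forall (Qlin_le_one r δ))
    filter_upwards [Filter.eventually_ge_atTop 1] with n hn
    exact one_sub_rpow_le_Qlin hr0 hr1 hδ0 hδ1 hn
  · intro hr
    obtain ⟨η, hη, hη'⟩ := exists_between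
      (show 1 - r < qEntropy (Fintype.card F) δ by rw [gvBound] at hr; linarith)
    have hlim := (tendsto_rpow_mul_natCast_atTop_zero hq
      (show 1 - η - r < 0 by linarith)).const_mul (4 * (Fintype.card F : ℝ) ^ 2)
    rw [mul_zero] at hlim
    refine tendsto_of_tendsto_of_tendsto_of_le_of_le' tendsto_const_nhds hlim
      (Filter.Eventually.of_forall (Qlin_nonneg r δ)) ?_
    have hlarge : ∀ᶠ n : ℕ in Filter.atTop, 1 ≤ r * n :=
      (tendsto_natCast_atTop_atTop.const_mul_atTop hr0).eventually_ge_atTop 1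
    filter_upwards [hlarge, eventually_half_rpow_le_card_puncturedBall hδ0 hδ1 hη'] with n hn hB
    exact Qlin_le_rpow hr1 hn hB
end

section
/- Let F be a finite field with q elements, δ ∈ (0, 1−1/q) and 0 < r < g_q(δ). Then there exist linear codes C_1, C_2, … over F, with C_i of length n_i and n_i → ∞, such that lim_{i→∞} R(C_i) = r and Δ(C_i) > δ for all i = 1, 2, …. -/
/-- If `B` is a set of vectors containing `0` and stable under scaling with
`#F ^ k * #B < #V`, then some `k`-dimensional subspace of `V` meets `B` only in `0`. -/
theorem Submodule.exists_finrank_eq_and_forall_notMem {F V : Type*} [Field F] [Fintype F]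
    [AddCommGroup V] [Module F V] [Fintype V] (B : Finset V) (hB0 : 0 ∈ B)
    (hB : ∀ (a : F), ∀ x ∈ B, a • x ∈ B) (k : ℕ)
    (hk : Fintype.card F ^ k * B.card < Fintype.card V) :
    ∃ C : Submodule F V, Module.finrank F C = k ∧ ∀ c ∈ C, c ≠ 0 → c ∉ B := by
  classical
  induction k with
  | zero => exact ⟨⊥, finrank_bot F V, fun c hc h => absurd ((Submodule.mem_bot F).1 hc) h⟩
  | succ k ih =>
    have hle : Fintype.card F ^ k ≤ Fintype.card F ^ (k + 1) :=
      Nat.pow_le_pow_right Fintype.card_pos k.le_succ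
    have hlt : Fintype.card F ^ k * B.card < Fintype.card V :=
      (Nat.mul_le_mul_right _ hle).trans_lt hk
    obtain ⟨C, hC, hCB⟩ := ih hlt
    have hcard : Fintype.card C = Fintype.card F ^ k := by
      rw [Module.card_eq_pow_finrank (K := F), hC]
    obtain ⟨x, hx⟩ : ∃ x : V, ∀ c ∈ C, ∀ b ∈ B, c + b ≠ x := by
      by_contra! h
      have hsub : (Finset.univ : Finset V) ⊆
          ((Finset.univ : Finset C) ×ˢ B).image (fun p => (p.1 : V) + p.2) := by
        intro x _
        obtain ⟨c, hc, b, hb, e⟩ := h x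
        exact Finset.mem_image.2 ⟨(⟨c, hc⟩, b), by simp [hb], e⟩
      have h1 := (Finset.card_le_card hsub).trans Finset.card_image_le
      rw [Finset.card_product, Finset.card_univ, Finset.card_univ, hcard] at h1
      exact absurd h1 hlt.not_ge
    have hxC : x ∉ C := fun h => hx x h 0 hB0 (add_zero x)
    refine ⟨C ⊔ Submodule.span F {x}, ?_, ?_⟩
    · rw [finrank_sup_span_singleton hxC, hC]
    · intro y hy hy0 hyB
      obtain ⟨c, hc, z, hz, rfl⟩ := Submodule.mem_sup.1 hy
      obtain ⟨a, rfl⟩ := Submodule.mem_span_singleton.1 hz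
      by_cases ha : a = 0
      · subst ha
        simp only [zero_smul, add_zero] at hy0 hyB
        exact hCB c hc hy0 hyB
      · refine hx (-(a⁻¹ • c)) (C.neg_mem (C.smul_mem _ hc)) _ (hB a⁻¹ _ hyB) ?_
        rw [smul_add, smul_smul, inv_mul_cancel₀ ha, one_smul]
        abel

/-- The weight enumerator of `F ^ n`. -/
theorem sum_pow_hammingNorm {F R : Type*} [Fintype F] [DecidableEq F] [Zero F] [CommRing R]
    (n : ℕ) (t : R) :
    ∑ x : Fin n → F, t ^ hammingNorm x = (1 + ((Fintype.card F : R) - 1) * t) ^ n := by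
  have h : ∑ a : F, (if a ≠ 0 then t else 1) = 1 + ((Fintype.card F : R) - 1) * t := by
    rw [← Finset.add_sum_erase _ _ (Finset.mem_univ (0 : F)),
      Finset.sum_congr rfl (g := fun _ => t) fun a ha => by simp [Finset.ne_of_mem_erase ha]]
    simp [Finset.card_erase_of_mem, Nat.cast_sub (Fintype.card_pos_iff.2 ⟨(0 : F)⟩)]
  rw [← h, Fintype.sum_pow]
  refine Finset.sum_congr rfl fun x _ => ?_
  rw [Finset.prod_ite]
  simp [hammingNorm]

/-- Entropy bound on the size of a Hamming ball of relative radius `δ`. -/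
theorem card_hammingNorm_le_le_rpow {F : Type*} [Fintype F] [DecidableEq F] [Zero F]
    {δ : ℝ} (hδ0 : 0 < δ) (hδ1 : δ < 1 - 1 / (Fintype.card F : ℝ)) (n : ℕ) :
    ((Finset.univ.filter fun x : Fin n → F => (hammingNorm x : ℝ) ≤ δ * n).card : ℝ) ≤
      (Fintype.card F : ℝ) ^ (qEntropy (Fintype.card F) δ * n) := by
  have hcard : 0 < Fintype.card F := Fintype.card_pos_iff.2 ⟨0⟩
  have hq0 : (0 : ℝ) < Fintype.card F := by exact_mod_cast hcard
  set q : ℝ := (Fintype.card F : ℝ) with hq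
  have hmul : q * δ < q - 1 := by
    have := mul_lt_mul_of_pos_left hδ1 hq0
    rwa [mul_sub, mul_one, mul_one_div_cancel hq0.ne'] at this
  have hq1 : 0 < q - 1 := (mul_pos hq0 hδ0).trans hmul
  have hδ : 0 < 1 - δ := by
    have : 0 < 1 / q := by positivity
    linarith
  set t : ℝ := δ / ((q - 1) * (1 - δ)) with ht
  have ht0 : 0 < t := by positivity
  have ht1 : t ≤ 1 := by
    rw [ht, div_le_one (by positivity)]
    nlinarith
  have hsum : 1 + (q - 1) * t = (1 - δ)⁻¹ := by
    rw [ht]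
    field_simp
    ring
  have hlogq : Real.log q ≠ 0 := (Real.log_pos (by linarith)).ne'
  have hentropy : q ^ (qEntropy (Fintype.card F) δ * n) = (t ^ (δ * n))⁻¹ * ((1 - δ)⁻¹) ^ n := by
    rw [← Real.rpow_natCast, ← Real.rpow_neg ht0.le, Real.rpow_def_of_pos hq0,
      Real.rpow_def_of_pos ht0, Real.rpow_def_of_pos (inv_pos.2 hδ), ← Real.exp_add, ht,
      Real.log_div hδ0.ne' (by positivity), Real.log_mul hq1.ne' hδ.ne', Real.log_inv,
      qEntropy, Real.logb, Real.logb, Real.logb, ← hq]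
    congr 1
    field_simp
    ring
  rw [hentropy, inv_mul_eq_div, le_div_iff₀ (Real.rpow_pos_of_pos ht0 _), ← hsum, hq,
    ← sum_pow_hammingNorm, ← nsmul_eq_mul, ← Finset.sum_const]
  refine (Finset.sum_le_sum fun x hx => ?_).trans
    (Finset.sum_le_sum_of_subset_of_nonneg (Finset.filter_subset _ _) fun x _ _ =>
      pow_nonneg ht0.le _)
  rw [← Real.rpow_natCast]
  exact Real.rpow_le_rpow_of_exponent_ge ht0 ht1 (Finset.mem_filter.1 hx).2

/-- for any `0 < r < g_q(δ)` there is a sequence of linear codes whose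
lengths tend to infinity, whose rates converge to `r`, and whose relative minimum
distances all exceed `δ`. -/
theorem statement4 (F : Type) [Field F] [Fintype F] [DecidableEq F]
    (q : ℕ) (hq : q = Fintype.card F) (r δ : ℝ)
    (hδ0 : 0 < δ) (hδ1 : δ < 1 - 1 / (q : ℝ))
    (hr0 : 0 < r) (hr1 : r < gvBound q δ) :
    ∃ (n : ℕ → ℕ) (C : (i : ℕ) → Submodule F (Fin (n i) → F)),
      Filter.Tendsto n Filter.atTop Filter.atTop ∧
      Filter.Tendsto (fun i => (Module.finrank F (C i) : ℝ) / (n i))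
        Filter.atTop (nhds r) ∧
      ∀ i, ∀ c ∈ C i, c ≠ 0 → δ * (n i) < (hammingNorm c : ℝ) := by
  subst hq
  have hq1 : (1 : ℝ) < Fintype.card F := by exact_mod_cast Fintype.one_lt_card
  have hcode (i : ℕ) : ∃ C : Submodule F (Fin (i + 1) → F),
      Module.finrank F C = ⌊r * ((i + 1 : ℕ) : ℝ)⌋₊ ∧
      ∀ c ∈ C, c ≠ 0 → δ * ((i + 1 : ℕ) : ℝ) < (hammingNorm c : ℝ) := by
    have hn : (0 : ℝ) < ((i + 1 : ℕ) : ℝ) := by positivity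
    obtain ⟨C, hC, hCB⟩ := Submodule.exists_finrank_eq_and_forall_notMem (F := F)
      (Finset.univ.filter fun x : Fin (i + 1) → F =>
        (hammingNorm x : ℝ) ≤ δ * ((i + 1 : ℕ) : ℝ))
      (by simp only [Finset.mem_filter_univ, hammingNorm_zero, Nat.cast_zero]; positivity)
      (fun a x hx => by
        rw [Finset.mem_filter_univ] at hx ⊢
        exact (Nat.cast_le.2 hammingNorm_smul_le_hammingNorm).trans hx)
      ⌊r * ((i + 1 : ℕ) : ℝ)⌋₊ (by
        have hball := card_hammingNorm_le_le_rpow (F := F) hδ0 hδ1 (i + 1)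
        have hfloor : (Fintype.card F : ℝ) ^ ⌊r * ((i + 1 : ℕ) : ℝ)⌋₊ ≤
            (Fintype.card F : ℝ) ^ (r * ((i + 1 : ℕ) : ℝ)) := by
          rw [← Real.rpow_natCast]
          exact Real.rpow_le_rpow_of_exponent_le hq1.le (Nat.floor_le (by positivity))
        rw [← Nat.cast_lt (α := ℝ), Fintype.card_fun, Fintype.card_fin, Nat.cast_mul,
          Nat.cast_pow, Nat.cast_pow]
        refine (mul_le_mul hfloor hball (Nat.cast_nonneg _) (by positivity)).trans_lt ?_
        rw [← Real.rpow_add (by linarith), ← Real.rpow_natCast]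
        refine Real.rpow_lt_rpow_of_exponent_lt hq1 ?_
        rw [gvBound] at hr1
        nlinarith)
    refine ⟨C, hC, fun c hc hc0 => ?_⟩
    simpa using hCB c hc hc0
  choose C hC hCδ using hcode
  refine ⟨fun i => i + 1, C, Filter.tendsto_add_atTop_nat 1, ?_, hCδ⟩
  simp only [hC]
  exact (tendsto_nat_floor_mul_div_atTop hr0.le).comp
    (tendsto_natCast_atTop_atTop.comp (Filter.tendsto_add_atTop_nat 1))
end
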